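/- arXiv:1206.1166 — 2 statements merged into one kernel-verified Lean document; each statement's English description precedes it below -/
import Mathlib

section
/- For every real x > 0, e^{−x} = ∑_{k=0}^∞ ∑_{n=1}^∞ 2^k μ(n) / (exp(x n 2^k) + 1), with all series converging absolutely. -/
open ArithmeticFunction

/-- The dyadic telescoping series coming from
`1 / (exp u + 1) = 1 / (exp u - 1) - 2 / (exp (2 * u) - 1)`. -/
theorem hasSum_two_pow_div_exp_add_one {t : ℝ} (ht : 0 < t) :
    HasSum (fun k : ℕ => (2 : ℝ) ^ k / (Real.exp (t * 2 ^ k) + 1)) (1 / (Real.exp t - 1)) := by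
  have hpos (k : ℕ) : 0 < Real.exp (t * 2 ^ k) - 1 :=
    sub_pos.2 (Real.one_lt_exp_iff.2 (by positivity))
  have htelescope (N : ℕ) :
      ∑ k ∈ Finset.range N, (2 : ℝ) ^ k / (Real.exp (t * 2 ^ k) + 1) =
        1 / (Real.exp t - 1) - 2 ^ N / (Real.exp (t * 2 ^ N) - 1) := by
    induction N with
    | zero => simp
    | succ N ih =>
      have hsq : Real.exp (t * 2 ^ (N + 1)) = Real.exp (t * 2 ^ N) ^ 2 := by
        rw [← Real.exp_nat_mul]
        congr 1
        push_cast
        ring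
      have hfactor : Real.exp (t * 2 ^ N) ^ 2 - 1 =
          (Real.exp (t * 2 ^ N) - 1) * (Real.exp (t * 2 ^ N) + 1) := by ring
      have hminus := (hpos N).ne'
      have hplus : Real.exp (t * 2 ^ N) + 1 ≠ 0 := by positivity
      rw [Finset.sum_range_succ, ih, hsq, hfactor, pow_succ]
      generalize 1 / (Real.exp t - 1) = a
      generalize Real.exp (t * 2 ^ N) = y at hminus hplus ⊢
      field_simp
      ring
  have hlim : Filter.Tendsto (fun N : ℕ => (2 : ℝ) ^ N / (Real.exp (t * 2 ^ N) - 1))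
      Filter.atTop (nhds 0) := by
    have hgeom : Filter.Tendsto (fun N : ℕ => 2 / t ^ 2 * (1 / 2 : ℝ) ^ N)
        Filter.atTop (nhds 0) := by
      simpa using (tendsto_pow_atTop_nhds_zero_of_lt_one
        (by norm_num : (0 : ℝ) ≤ 1 / 2) (by norm_num)).const_mul (2 / t ^ 2)
    refine squeeze_zero (fun N => div_nonneg (by positivity) (hpos N).le) (fun N => ?_) hgeom
    have hu : 0 ≤ t * 2 ^ N := by positivity
    have hbound := Real.quadratic_le_exp_of_nonneg hu
    calc (2 : ℝ) ^ N / (Real.exp (t * 2 ^ N) - 1)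
        ≤ 2 ^ N / ((t * 2 ^ N) ^ 2 / 2) := by
          gcongr
          linarith
      _ = 2 / t ^ 2 * (1 / 2) ^ N := by
          rw [one_div, inv_pow]
          field_simp
  rw [hasSum_iff_tendsto_nat_of_nonneg (fun k => by positivity)]
  simp_rw [htelescope]
  simpa using hlim.const_sub (1 / (Real.exp t - 1))

theorem hasSum_exp_neg_pow_pnat {t : ℝ} (ht : 0 < t) :
    HasSum (fun m : ℕ+ => Real.exp (-t) ^ (m : ℕ)) (1 / (Real.exp t - 1)) := by
  have hlt : Real.exp (-t) < 1 := by simpa using ht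
  have hgeom := (hasSum_geometric_of_lt_one (Real.exp_pos (-t)).le hlt).mul_left (Real.exp (-t))
  rw [← Equiv.pnatEquivNat.symm.hasSum_iff]
  convert! hgeom using 1
  · ext m
    simp [pow_succ']
  · have h := sub_ne_zero.2 (Real.one_lt_exp_iff.2 ht).ne'
    rw [Real.exp_neg]
    field_simp

/-- The Lambert series of the Möbius function, as a double series. -/
theorem hasSum_moebius_mul_pow_mul {r : ℝ} (hr : ‖r‖ < 1) :
    HasSum (fun p : ℕ+ × ℕ+ => (moebius (p.1 : ℕ) : ℝ) * r ^ (p.1 * p.2 : ℕ)) r := by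
  have hsummable :
      Summable (fun p : ℕ+ × ℕ+ => (moebius (p.1 : ℕ) : ℝ) * r ^ (p.1 * p.2 : ℕ)) := by
    refine Summable.of_norm_bounded (summable_prod_mul_pow 0 hr).norm fun p => ?_
    rw [pow_zero, one_mul, norm_mul]
    refine mul_le_of_le_one_left (norm_nonneg _) ?_
    rw [Real.norm_eq_abs]
    exact_mod_cast abs_moebius_le_one
  have hfiber (n : ℕ+) :
      ∑ x : Nat.divisorsAntidiagonal n,
        (moebius (x.1.1 : ℕ) : ℝ) * r ^ (x.1.1 * x.1.2 : ℕ) = if n = 1 then r else 0 := by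
    have hmoebius : ∑ x ∈ Nat.divisorsAntidiagonal n, (moebius x.1 : ℝ) =
        if n = 1 then 1 else 0 := by
      rw [Nat.sum_divisorsAntidiagonal (fun d _ => (moebius d : ℝ))]
      have h : ∑ d ∈ (n : ℕ).divisors, moebius d = if (n : ℕ) = 1 then 1 else 0 := by
        rw [← coe_mul_zeta_apply, moebius_mul_coe_zeta, one_apply]
      simpa using congrArg (Int.cast : ℤ → ℝ) h
    rw [Finset.univ_eq_attach, Finset.sum_attach (Nat.divisorsAntidiagonal n)
      (fun x => (moebius x.1 : ℝ) * r ^ (x.1 * x.2))]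
    rw [Finset.sum_congr rfl fun x hx => by rw [(Nat.mem_divisorsAntidiagonal.1 hx).1],
      ← Finset.sum_mul, hmoebius]
    split_ifs with h <;> simp [h]
  have hsigma := (sigmaAntidiagonalEquivProd.hasSum_iff.2 hsummable.hasSum).sigma
    (fun n => hasSum_fintype _)
  have hr_sum : HasSum (fun n : ℕ+ => if n = 1 then r else 0) r := hasSum_ite_eq 1 r
  have heq := (hsigma.congr_fun (fun n => (hfiber n).symm)).unique hr_sum
  exact hsummable.hasSum_iff.2 heq

theorem lambert_moebius_dyadic (x : ℝ) (hx : 0 < x) :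
    Summable (fun p : ℕ × ℕ+ =>
      |(2 : ℝ) ^ p.1 * (moebius (p.2 : ℕ) : ℝ) / (Real.exp (x * p.2 * 2 ^ p.1) + 1)|) ∧
    ∑' p : ℕ × ℕ+,
      (2 : ℝ) ^ p.1 * (moebius (p.2 : ℕ) : ℝ) / (Real.exp (x * p.2 * 2 ^ p.1) + 1) =
      Real.exp (-x) := by
  have hr : ‖Real.exp (-x)‖ < 1 := by simpa using hx
  have hpos (n : ℕ+) : 0 < x * n := mul_pos hx (by exact_mod_cast n.pos)
  have hpow (n m : ℕ+) : Real.exp (-x) ^ (n * m : ℕ) = Real.exp (-(x * n)) ^ (m : ℕ) := by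
    rw [pow_mul, ← Real.exp_nat_mul]
    ring_nf
  have hinner (n : ℕ+) := hasSum_two_pow_div_exp_add_one (hpos n)
  have hmoebius : HasSum (fun n : ℕ+ => (moebius (n : ℕ) : ℝ) * (1 / (Real.exp (x * n) - 1)))
      (Real.exp (-x)) := by
    refine (hasSum_moebius_mul_pow_mul hr).prod_fiberwise fun n => ?_
    simp_rw [hpow]
    exact (hasSum_exp_neg_pow_pnat (hpos n)).mul_left _
  have hswap : Summable (fun p : ℕ+ × ℕ =>
      |(moebius (p.1 : ℕ) : ℝ) * (2 ^ p.2 / (Real.exp (x * p.1 * 2 ^ p.2) + 1))|) := by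
    have habs (n : ℕ+) (k : ℕ) :
        |(moebius (n : ℕ) : ℝ) * (2 ^ k / (Real.exp (x * n * 2 ^ k) + 1))| =
          |(moebius (n : ℕ) : ℝ)| * (2 ^ k / (Real.exp (x * n * 2 ^ k) + 1)) := by
      rw [abs_mul, abs_of_nonneg (by positivity : (0 : ℝ) ≤ 2 ^ k / _)]
    rw [summable_prod_of_nonneg fun p => abs_nonneg _]
    simp_rw [habs]
    refine ⟨fun n => ((hinner n).mul_left _).summable, ?_⟩
    refine hmoebius.summable.abs.congr fun n => ?_
    rw [((hinner n).mul_left _).tsum_eq, abs_mul,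
      abs_of_pos (one_div_pos.2 (sub_pos.2 (Real.one_lt_exp_iff.2 (hpos n))))]
  have hterm (p : ℕ × ℕ+) :
      (2 : ℝ) ^ p.1 * (moebius (p.2 : ℕ) : ℝ) / (Real.exp (x * p.2 * 2 ^ p.1) + 1) =
        (moebius (p.2 : ℕ) : ℝ) * (2 ^ p.1 / (Real.exp (x * p.2 * 2 ^ p.1) + 1)) := by
    ring
  simp_rw [hterm]
  refine ⟨hswap.prod_symm, ?_⟩
  have hsum : HasSum (fun p : ℕ+ × ℕ =>
      (moebius (p.1 : ℕ) : ℝ) * (2 ^ p.2 / (Real.exp (x * p.1 * 2 ^ p.2) + 1)))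
      (Real.exp (-x)) := by
    refine hswap.of_abs.hasSum_iff.2 ?_
    rw [hswap.of_abs.tsum_prod, ← hmoebius.tsum_eq]
    exact tsum_congr fun n => ((hinner n).mul_left (moebius (n : ℕ) : ℝ)).tsum_eq
  exact ((Equiv.prodComm ℕ ℕ+).hasSum_iff.2 hsum).tsum_eq
end

section
/- For all x > 0 and real τ, |∑_{n=1}^∞ K_{iτ}(nx)| ≤ e^{−rτ} ∑_{n=1}^∞ K_0(nx cos r) for every r ∈ [0, π/2), where K_ν denotes the modified Bessel function of the second kind given by K_{iτ}(y) = ∫_0^∞ e^{−y cosh u} cos(τu) du and K_0(y) = ∫_0^∞ e^{−y cosh u} du. -/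
open Real MeasureTheory

open Filter Topology

theorem Real.sq_div_four_le_cosh (u : ℝ) : u ^ 2 / 4 ≤ Real.cosh u := by
  rw [← Real.cosh_abs, Real.cosh_eq, ← sq_abs]
  have h₁ := Real.quadratic_le_exp_of_nonneg (abs_nonneg u)
  have h₂ := Real.exp_pos (-|u|)
  have h₃ := abs_nonneg u
  linarith

theorem exp_neg_mul_cosh_le {c : ℝ} (hc : 0 ≤ c) (u : ℝ) :
    Real.exp (-c * Real.cosh u) ≤ Real.exp (-(c / 4) * u ^ 2) := by
  apply Real.exp_le_exp.2
  nlinarith [mul_le_mul_of_nonneg_left (Real.sq_div_four_le_cosh u) hc]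

theorem integrable_exp_neg_mul_cosh {c : ℝ} (hc : 0 < c) :
    Integrable fun u : ℝ => Real.exp (-c * Real.cosh u) := by
  refine (integrable_exp_neg_mul_sq (show 0 < c / 4 by positivity)).mono'
    (by fun_prop) (.of_forall fun u => ?_)
  rw [Real.norm_eq_abs, Real.abs_exp]
  exact exp_neg_mul_cosh_le hc.le u

theorem tendsto_exp_neg_mul_cosh_cocompact {c : ℝ} (hc : 0 < c) :
    Tendsto (fun u : ℝ => Real.exp (-c * Real.cosh u)) (cocompact ℝ) (𝓝 0) := by
  have h := tendsto_rpow_abs_mul_exp_neg_mul_sq_cocompact (show 0 < c / 4 by positivity) 0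
  simp only [Real.rpow_zero, one_mul] at h
  exact squeeze_zero (fun u => (Real.exp_pos _).le) (exp_neg_mul_cosh_le hc.le) h

/-- Horizontal contour shift for an entire function that decays uniformly on a strip. -/
theorem integral_add_mul_I_eq_integral {f : ℂ → ℂ} (hf : Differentiable ℂ f) {r : ℝ} (hr : 0 ≤ r)
    {b : ℝ → ℝ} (hb : Tendsto b (cocompact ℝ) (𝓝 0))
    (hfb : ∀ T : ℝ, ∀ s ∈ Set.Icc 0 r, ‖f (T + s * Complex.I)‖ ≤ b T)
    (hint : ∀ s ∈ Set.Icc 0 r, Integrable fun u : ℝ => f (u + s * Complex.I)) :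
    ∫ u : ℝ, f (u + r * Complex.I) = ∫ u : ℝ, f u := by
  have side : ∀ (l : ℝ → ℝ), Tendsto l atTop (cocompact ℝ) →
      Tendsto (fun T : ℝ => Complex.I • ∫ s in (0 : ℝ)..r, f ((l T : ℝ) + s * Complex.I))
        atTop (𝓝 0) := by
    intro l hl
    have h0 : Tendsto (fun T => b (l T) * |r - 0|) atTop (𝓝 0) := by
      simpa using (hb.comp hl).mul_const |r - 0|
    refine squeeze_zero_norm (fun T => ?_) h0
    rw [norm_smul, Complex.norm_I, one_mul]
    refine intervalIntegral.norm_integral_le_of_norm_le_const fun s hs => ?_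
    rw [Set.uIoc_of_le hr] at hs
    exact hfb _ _ ⟨hs.1.le, hs.2⟩
  have horizontal : ∀ s ∈ Set.Icc 0 r,
      Tendsto (fun T : ℝ => ∫ u in (-T)..T, f (u + s * Complex.I)) atTop
        (𝓝 (∫ u : ℝ, f (u + s * Complex.I))) := fun s hs =>
    intervalIntegral_tendsto_integral (hint s hs) tendsto_neg_atTop_atBot tendsto_id
  have hlim := (((horizontal 0 ⟨le_rfl, hr⟩).sub (horizontal r ⟨hr, le_rfl⟩)).add
    (side (fun T => T) atTop_le_cocompact)).sub
    (side (fun T => -T) (tendsto_neg_atTop_atBot.mono_right atBot_le_cocompact))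
  have hzero : ∀ T : ℝ, (∫ u in (-T)..T, f (u + (0 : ℝ) * Complex.I)) -
      (∫ u in (-T)..T, f (u + r * Complex.I)) +
      Complex.I • (∫ s in (0 : ℝ)..r, f ((T : ℝ) + s * Complex.I)) -
      Complex.I • (∫ s in (0 : ℝ)..r, f ((-T : ℝ) + s * Complex.I)) = 0 := fun T =>
    Complex.integral_boundary_rect_eq_zero_of_differentiableOn f ⟨-T, 0⟩ ⟨T, r⟩
      hf.differentiableOn
  have h := tendsto_nhds_unique hlim (tendsto_const_nhds.congr fun T => (hzero T).symm)
  simp only [Complex.ofReal_zero, zero_mul, add_zero, sub_zero] at h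
  exact (sub_eq_zero.1 h).symm

theorem Complex.norm_exp_neg_mul_cosh_add_mul_I (y τ u s : ℝ) :
    ‖Complex.exp (-y * Complex.cosh (u + s * Complex.I) + τ * (u + s * Complex.I) * Complex.I)‖ =
      Real.exp (-s * τ) * Real.exp (-(y * Real.cos s) * Real.cosh u) := by
  rw [Complex.norm_exp, ← Real.exp_add, Complex.cosh_add, Complex.cosh_mul_I, Complex.sinh_mul_I,
    ← Complex.ofReal_cosh, ← Complex.ofReal_cos, ← Complex.ofReal_sinh, ← Complex.ofReal_sin]
  congr 1
  simp [Complex.cos_ofReal_re]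
  ring

/-- `|K_{iτ}(y)| ≤ e^{-rτ} K₀(y cos r)`, in terms of the integral representations. -/
theorem abs_integral_exp_neg_mul_cosh_mul_cos_le {y : ℝ} (hy : 0 < y) (τ : ℝ) {r : ℝ}
    (hr : r ∈ Set.Ico 0 (π / 2)) :
    |∫ u in Set.Ioi (0 : ℝ), Real.exp (-y * Real.cosh u) * Real.cos (τ * u)| ≤
      Real.exp (-r * τ) * ∫ u in Set.Ioi (0 : ℝ), Real.exp (-(y * Real.cos r) * Real.cosh u) := by
  set f : ℂ → ℂ := fun z => Complex.exp (-y * Complex.cosh z + τ * z * Complex.I) with hf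
  have hnorm : ∀ u s : ℝ, ‖f (u + s * Complex.I)‖ =
      Real.exp (-s * τ) * Real.exp (-(y * Real.cos s) * Real.cosh u) :=
    fun u s => Complex.norm_exp_neg_mul_cosh_add_mul_I y τ u s
  have hdiff : Differentiable ℂ f := by
    have := Complex.differentiable_cosh
    fun_prop
  have hcos : ∀ s ∈ Set.Icc 0 r, Real.cos r ≤ Real.cos s := fun s hs =>
    Real.cos_le_cos_of_nonneg_of_le_pi hs.1 (by linarith [hr.2, Real.pi_pos]) hs.2
  have hcr : 0 < Real.cos r :=
    Real.cos_pos_of_mem_Ioo ⟨by linarith [hr.1, Real.pi_pos], hr.2⟩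
  have hint : ∀ s ∈ Set.Icc 0 r, Integrable fun u : ℝ => f (u + s * Complex.I) := fun s hs => by
    refine ((integrable_exp_neg_mul_cosh (mul_pos hy (hcr.trans_le (hcos s hs)))).const_mul
      (Real.exp (-s * τ))).mono' ?_ (.of_forall fun u => (hnorm u s).le)
    have := hdiff.continuous
    exact Continuous.aestronglyMeasurable (by fun_prop)
  have hshift : ∫ u : ℝ, f (u + r * Complex.I) = ∫ u : ℝ, f u := by
    refine integral_add_mul_I_eq_integral hdiff hr.1
      (b := fun u => Real.exp (r * |τ|) * Real.exp (-(y * Real.cos r) * Real.cosh u)) ?_ ?_ hint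
    · simpa using (tendsto_exp_neg_mul_cosh_cocompact (mul_pos hy hcr)).const_mul
        (Real.exp (r * |τ|))
    · intro u s hs
      rw [hnorm]
      have h₁ : -s * τ ≤ r * |τ| := by
        calc -s * τ ≤ s * |τ| := by nlinarith [neg_abs_le τ, hs.1]
          _ ≤ r * |τ| := mul_le_mul_of_nonneg_right hs.2 (abs_nonneg _)
      have h₂ := mul_le_mul_of_nonneg_right
        (mul_le_mul_of_nonneg_left (hcos s hs) hy.le) (Real.cosh_pos u).le
      gcongr Real.exp ?_ * Real.exp ?_
      linarith
  have hre : ∀ u : ℝ, RCLike.re (f u) = Real.exp (-y * Real.cosh |u|) * Real.cos (τ * |u|) := by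
    intro u
    have hc : Real.cos (τ * |u|) = Real.cos (τ * u) := by
      rcases abs_choice u with h | h <;> simp [h]
    rw [hc, Real.cosh_abs, hf]
    simp only [RCLike.re_eq_complex_re, Complex.exp_re, ← Complex.ofReal_cosh]
    simp
  have hleft : RCLike.re (∫ u : ℝ, f u) =
      2 * ∫ u in Set.Ioi (0 : ℝ), Real.exp (-y * Real.cosh u) * Real.cos (τ * u) := by
    have h0 := hint 0 ⟨le_rfl, hr.1⟩
    simp only [Complex.ofReal_zero, zero_mul, add_zero] at h0
    rw [← integral_re h0, ← integral_comp_abs]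
    exact integral_congr_ae (.of_forall hre)
  have hright : ∫ u : ℝ, Real.exp (-(y * Real.cos r) * Real.cosh u) =
      2 * ∫ u in Set.Ioi (0 : ℝ), Real.exp (-(y * Real.cos r) * Real.cosh u) := by
    rw [← integral_comp_abs]
    simp only [Real.cosh_abs]
  have hmain : |RCLike.re (∫ u : ℝ, f u)| ≤
      Real.exp (-r * τ) * ∫ u : ℝ, Real.exp (-(y * Real.cos r) * Real.cosh u) := by
    refine (RCLike.abs_re_le_norm _).trans ?_
    rw [← hshift, ← integral_const_mul]
    refine (norm_integral_le_integral_norm _).trans_eq ?_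
    simp only [hnorm]
  rw [hleft, hright, abs_mul, abs_two] at hmain
  linarith

theorem summable_integral_exp_neg_mul_cosh {a : ℝ} (ha : 0 < a) :
    Summable fun n : ℕ+ => ∫ u in Set.Ioi (0 : ℝ), Real.exp (-(n * a) * Real.cosh u) := by
  have hgeom : Summable fun n : ℕ+ => Real.exp (-a) ^ (n : ℕ) *
      (Real.exp a * ∫ u in Set.Ioi (0 : ℝ), Real.exp (-a * Real.cosh u)) :=
    ((summable_geometric_of_lt_one (Real.exp_pos _).le
      (Real.exp_lt_one_iff.2 (neg_lt_zero.2 ha))).comp_injective PNat.coe_injective).mul_right _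
  refine Summable.of_nonneg_of_le (fun n => integral_nonneg fun u => (Real.exp_pos _).le)
    (fun n => ?_) hgeom
  have hn : (1 : ℝ) ≤ n := by exact_mod_cast n.pos
  rw [← mul_assoc, ← integral_const_mul]
  refine setIntegral_mono
    (integrable_exp_neg_mul_cosh (mul_pos (by linarith) ha)).integrableOn
    ((integrable_exp_neg_mul_cosh ha).integrableOn.const_mul _) fun u => ?_
  simp only [← Real.exp_nat_mul, ← Real.exp_add]
  apply Real.exp_le_exp.2
  nlinarith [mul_nonneg (mul_nonneg (sub_nonneg.2 hn) ha.le) (sub_nonneg.2 (Real.one_le_cosh u))]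

theorem macdonald_lambert_bound (x τ : ℝ) (hx : 0 < x)
    (r : ℝ) (hr : r ∈ Set.Ico 0 (π / 2)) :
    |∑' n : ℕ+,
        ∫ u in Set.Ioi (0 : ℝ), Real.exp (-(n * x) * Real.cosh u) * Real.cos (τ * u)| ≤
      Real.exp (-r * τ) *
        ∑' n : ℕ+,
          ∫ u in Set.Ioi (0 : ℝ), Real.exp (-(n * x * Real.cos r) * Real.cosh u) := by
  have hcr : 0 < Real.cos r :=
    Real.cos_pos_of_mem_Ioo ⟨by linarith [hr.1, Real.pi_pos], hr.2⟩
  have hsum := summable_integral_exp_neg_mul_cosh (mul_pos hx hcr)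
  simp only [← mul_assoc] at hsum
  rw [← Real.norm_eq_abs]
  refine tsum_of_norm_bounded (hsum.hasSum.mul_left (Real.exp (-r * τ))) fun n => ?_
  exact abs_integral_exp_neg_mul_cosh_mul_cos_le
    (mul_pos (by exact_mod_cast n.pos) hx) τ hr
end
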